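/- If α is an irrational number that is equivalent neither to (1+√5)/2 nor to (1+√17)/2, then 𝔨(α) ≤ 164/(13√173). -/

import Mathlib

open Filter

/-- The tails `αₙ = [aₙ; aₙ₊₁, …]` of the continued fraction of `α`. -/
noncomputable def cfTail (α : ℝ) : ℕ → ℝ
  | 0 => α
  | n + 1 => (Int.fract (cfTail α n))⁻¹

/-- The partial quotients `aₙ` of the continued fraction of `α`. -/
noncomputable def cfDigit (α : ℝ) (n : ℕ) : ℤ := ⌊cfTail α n⌋

/-- Value `[a; b, c, …]` of a finite continued fraction given by a list. -/
noncomputable def finCF : List ℤ → ℝ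
  | [] => 0
  | a :: l => (a : ℝ) + (finCF l)⁻¹

/-- `α*ₙ = [0; aₙ, aₙ₋₁, …, a₁]`. -/
noncomputable def cfStar (α : ℝ) (n : ℕ) : ℝ :=
  (finCF (((List.range' 1 n).reverse).map (cfDigit α)))⁻¹

/-- Numerators `pₙ` of the convergents of `α`. -/
noncomputable def cfNum (α : ℝ) : ℕ → ℤ
  | 0 => cfDigit α 0
  | 1 => cfDigit α 1 * cfDigit α 0 + 1
  | n + 2 => cfDigit α (n + 2) * cfNum α (n + 1) + cfNum α n

/-- Denominators `qₙ` of the convergents of `α`. -/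
noncomputable def cfDen (α : ℝ) : ℕ → ℤ
  | 0 => 1
  | 1 => cfDigit α 1
  | n + 2 => cfDigit α (n + 2) * cfDen α (n + 1) + cfDen α n

/-- The irrationality measure function `ψ_α^[2]` for "second best" approximations. -/
noncomputable def psi2 (α : ℝ) (t : ℝ) : ℝ :=
  sInf { x : ℝ | ∃ p q : ℤ, 1 ≤ q ∧ (q : ℝ) ≤ t ∧
    (∀ n : ℕ, (p, q) ≠ (cfNum α n, cfDen α n)) ∧ x = |(q : ℝ) * α - (p : ℝ)| }

/-- The Diophantine constant `𝔨(α) = liminf_{t → ∞} t · ψ_α^[2](t)`. -/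
noncomputable def kConst (α : ℝ) : ℝ := liminf (fun t : ℝ => t * psi2 α t) atTop

/-- Two numbers are equivalent if the tails of their continued fraction expansions
coincide: `a_{n+k} = b_{m+k}` for all `k ≥ 1`, for some positive integers `m`, `n`. -/
def CFEquiv (α β : ℝ) : Prop :=
  ∃ n m : ℕ, 0 < n ∧ 0 < m ∧ ∀ k : ℕ, 0 < k → cfDigit α (n + k) = cfDigit β (m + k)

/-- The spectrum `𝕃₂` of values of `𝔨`. -/
def L2 : Set ℝ := { l : ℝ | ∃ α : ℝ, Irrational α ∧ l = kConst α }

/-- `κ¹ₙ(α) = (1 + α*ₙ₋₁)(αₙ − 1)/(αₙ + α*ₙ₋₁)`. -/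
noncomputable def kappa1 (α : ℝ) (n : ℕ) : ℝ :=
  (1 + cfStar α (n - 1)) * (cfTail α n - 1) / (cfTail α n + cfStar α (n - 1))

/-- `κ²ₙ(α) = (1 − α*ₙ)(αₙ₊₁ + 1)/(αₙ₊₁ + α*ₙ)`. -/
noncomputable def kappa2 (α : ℝ) (n : ℕ) : ℝ :=
  (1 - cfStar α n) * (cfTail α (n + 1) + 1) / (cfTail α (n + 1) + cfStar α n)

/-- `κ⁴ₙ(α) = 4/(αₙ + α*ₙ₋₁)`. -/
noncomputable def kappa4 (α : ℝ) (n : ℕ) : ℝ :=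
  4 / (cfTail α n + cfStar α (n - 1))

/-! ### Two-sided digit sequences -/

/-- A sequence of digits `a` with its right tails `y n = [0; aₙ₊₁, aₙ₊₂, …]` and its left tails
`x n = [0; aₙ₋₁, aₙ₋₂, …]`, along which two of the constants `κ` stay large. -/
structure LargeKappa (a : ℕ → ℤ) (x y : ℕ → ℝ) : Prop where
  one_le : ∀ n, 1 ≤ a n
  x_nonneg : ∀ n, 0 ≤ x n
  x_le_one : ∀ n, x n ≤ 1
  y_nonneg : ∀ n, 0 ≤ y n
  y_le_one : ∀ n, y n ≤ 1
  x_succ : ∀ n, x (n + 1) = ((a n : ℝ) + x n)⁻¹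
  y_eq : ∀ n, y n = ((a (n + 1) : ℝ) + y (n + 1))⁻¹
  sum_le : ∀ n, (a n : ℝ) + x n + y n ≤ 4.1705
  second_ge : ∀ n, 2 ≤ a n → 0.959 * ((a n : ℝ) + x n + y n) ≤ ((a n : ℝ) - 1 + x n) * (1 + y n)

theorem le_of_eq_inv_add {u d z hi l : ℝ} (hu : u = (d + z)⁻¹) (hd : 1 ≤ d) (hz : 0 ≤ z)
    (hl : 0 ≤ l) (h : z ≤ hi) (hlu : l * (d + hi) ≤ 1) : l ≤ u := by
  have hpos : 0 < d + z := by linarith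
  rw [hu, ← one_div, le_div_iff₀ hpos]
  nlinarith

theorem ge_of_eq_inv_add {u d z lo r : ℝ} (hu : u = (d + z)⁻¹) (hd : 1 ≤ d) (hz : 0 ≤ z)
    (hr : 0 ≤ r) (h : lo ≤ z) (hru : 1 ≤ r * (d + lo)) : u ≤ r := by
  have hpos : 0 < d + z := by linarith
  rw [hu, ← one_div, div_le_iff₀ hpos]
  nlinarith

namespace LargeKappa

variable {a : ℕ → ℤ} {x y : ℕ → ℝ}

theorem shift (h : LargeKappa a x y) (k : ℕ) :
    LargeKappa (fun n => a (n + k)) (fun n => x (n + k)) (fun n => y (n + k)) where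
  one_le n := h.one_le _
  x_nonneg n := h.x_nonneg _
  x_le_one n := h.x_le_one _
  y_nonneg n := h.y_nonneg _
  y_le_one n := h.y_le_one _
  x_succ n := by rw [← h.x_succ]; congr 1; omega
  y_eq n := by rw [h.y_eq, show n + 1 + k = n + k + 1 by omega]
  sum_le n := h.sum_le _
  second_ge n := h.second_ge _

theorem one_le_cast (h : LargeKappa a x y) (n : ℕ) : (1 : ℝ) ≤ a n := by
  exact_mod_cast h.one_le n

theorem le_y (h : LargeKappa a x y) {n : ℕ} {d : ℤ} {hi l : ℝ} (hd : a (n + 1) = d)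
    (hy : y (n + 1) ≤ hi) (hl : 0 ≤ l) (hlu : l * (d + hi) ≤ 1) : l ≤ y n := by
  subst hd
  exact le_of_eq_inv_add (h.y_eq n) (h.one_le_cast _) (h.y_nonneg _) hl hy hlu

theorem y_le (h : LargeKappa a x y) {n : ℕ} {d : ℤ} {lo r : ℝ} (hd : a (n + 1) = d)
    (hy : lo ≤ y (n + 1)) (hr : 0 ≤ r) (hru : 1 ≤ r * (d + lo)) : y n ≤ r := by
  subst hd
  exact ge_of_eq_inv_add (h.y_eq n) (h.one_le_cast _) (h.y_nonneg _) hr hy hru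

theorem le_x (h : LargeKappa a x y) {n : ℕ} {d : ℤ} {hi l : ℝ} (hd : a n = d)
    (hx : x n ≤ hi) (hl : 0 ≤ l) (hlu : l * (d + hi) ≤ 1) : l ≤ x (n + 1) := by
  subst hd
  exact le_of_eq_inv_add (h.x_succ n) (h.one_le_cast _) (h.x_nonneg _) hl hx hlu

theorem x_le (h : LargeKappa a x y) {n : ℕ} {d : ℤ} {lo r : ℝ} (hd : a n = d)
    (hx : lo ≤ x n) (hr : 0 ≤ r) (hru : 1 ≤ r * (d + lo)) : x (n + 1) ≤ r := by
  subst hd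
  exact ge_of_eq_inv_add (h.x_succ n) (h.one_le_cast _) (h.x_nonneg _) hr hx hru

theorem digit_le_four (h : LargeKappa a x y) (n : ℕ) : a n ≤ 4 := by
  have h1 := h.sum_le n
  have h2 := h.x_nonneg n
  have h3 := h.y_nonneg n
  have : (a n : ℝ) < 5 := by linarith
  have : a n < 5 := by exact_mod_cast this
  omega

theorem one_fifth_le_x (h : LargeKappa a x y) (n : ℕ) : 1 / 5 ≤ x (n + 1) := by
  have : (a n : ℝ) ≤ 4 := by exact_mod_cast h.digit_le_four n
  exact h.le_x rfl (h.x_le_one n) (by norm_num) (by linarith)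

theorem one_fifth_le_y (h : LargeKappa a x y) (n : ℕ) : 1 / 5 ≤ y n := by
  have : (a (n + 1) : ℝ) ≤ 4 := by exact_mod_cast h.digit_le_four (n + 1)
  exact h.le_y rfl (h.y_le_one _) (by norm_num) (by linarith)

theorem digit_le_three (h : LargeKappa a x y) (n : ℕ) : a (n + 1) ≤ 3 := by
  by_contra! h4
  have h1 := h.sum_le (n + 1)
  have h2 := h.one_fifth_le_x n
  have h3 := h.one_fifth_le_y (n + 1)
  have : (4 : ℝ) ≤ a (n + 1) := by exact_mod_cast h4
  linarith

theorem x_le_four_fifths (h : LargeKappa a x y) (n : ℕ) : x (n + 3) ≤ 4 / 5 := by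
  have h3 : (a (n + 1) : ℝ) ≤ 3 := by exact_mod_cast h.digit_le_three n
  have : 1 / 4 ≤ x (n + 2) :=
    h.le_x rfl (h.x_le_one _) (by norm_num) (by linarith)
  exact h.x_le rfl this (by norm_num) (by linarith [h.one_le_cast (n + 2)])

theorem y_le_four_fifths (h : LargeKappa a x y) (n : ℕ) : y n ≤ 4 / 5 := by
  have h3 : (a (n + 2) : ℝ) ≤ 3 := by exact_mod_cast h.digit_le_three (n + 1)
  have : 1 / 4 ≤ y (n + 1) :=
    h.le_y rfl (h.y_le_one _) (by norm_num) (by linarith)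
  exact h.y_le rfl this (by norm_num) (by linarith [h.one_le_cast (n + 1)])

theorem digit_eq (h : LargeKappa a x y) (n : ℕ) : a (n + 3) = 1 ∨ a (n + 3) = 3 := by
  have h1 := h.one_le (n + 3)
  have h3 : a (n + 3) ≤ 3 := h.digit_le_three (n + 2)
  by_contra! hne
  have h2 : a (n + 3) = 2 := by omega
  have hs := h.second_ge (n + 3) (by omega)
  have hx := h.x_le_four_fifths n
  have hy := h.y_le_four_fifths (n + 3)
  have hx0 := h.x_nonneg (n + 3)
  have hy0 := h.y_nonneg (n + 3)
  rw [h2] at hs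
  push_cast at hs
  nlinarith [mul_nonneg (sub_nonneg.2 hx) hy0, mul_nonneg (sub_nonneg.2 hy) hx0]

theorem eq_one_of_eq_three (h : LargeKappa a x y) {n : ℕ} (h3 : a (n + 3) = 3) :
    a (n + 4) = 1 := by
  refine (h.digit_eq (n + 1)).resolve_right fun h3' => ?_
  have hs := h.second_ge (n + 3) (by omega)
  have hx := h.x_le_four_fifths n
  have hx0 := h.x_nonneg (n + 3)
  have hy0 := h.y_nonneg (n + 3)
  have hy : y (n + 3) ≤ 1 / 3 := h.y_le h3' (h.y_nonneg _) (by norm_num) (by norm_num)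
  rw [h3] at hs
  push_cast at hs
  nlinarith [mul_nonneg (sub_nonneg.2 hx) hy0, mul_nonneg (sub_nonneg.2 hy) hx0]

theorem pred_eq_one_of_eq_three (h : LargeKappa a x y) {n : ℕ} (h3 : a (n + 4) = 3) :
    a (n + 3) = 1 := by
  refine (h.digit_eq n).resolve_right fun h3' => ?_
  have := h.eq_one_of_eq_three h3'
  omega

theorem ne_three_add_two (h : LargeKappa a x y) {n : ℕ} (h3 : a (n + 4) = 3) :
    a (n + 6) ≠ 3 := by
  intro h3'
  have h1 : a (n + 5) = 1 := h.eq_one_of_eq_three (n := n + 1) h3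
  have h1' := h.pred_eq_one_of_eq_three h3
  have hs := h.sum_le (n + 4)
  have hx : 5 / 9 ≤ x (n + 4) :=
    h.le_x h1' (h.x_le_four_fifths n) (by norm_num) (by norm_num)
  have hy' : y (n + 5) ≤ 1 / 3 := h.y_le h3' (h.y_nonneg _) (by norm_num) (by norm_num)
  have hy : 3 / 4 ≤ y (n + 4) := h.le_y h1 hy' (by norm_num) (by norm_num)
  rw [h3] at hs
  push_cast at hs
  linarith

end LargeKappa

/-- A `LargeKappa` sequence all of whose digits are `1` or `3`, any two digits `3` being separated
by at least two digits `1`. -/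
structure SparseThrees (a : ℕ → ℤ) (x y : ℕ → ℝ) : Prop extends LargeKappa a x y where
  digit : ∀ n, a n = 1 ∨ a n = 3
  one_of_three : ∀ n, a n = 3 → a (n + 1) = 1 ∧ a (n + 2) = 1
  x_ge : ∀ n, a n = 3 → 5 / 9 ≤ x n
  y_ge : ∀ n, a n = 3 → 5 / 9 ≤ y n

theorem LargeKappa.sparseThrees {a : ℕ → ℤ} {x y : ℕ → ℝ} (h : LargeKappa a x y) :
    SparseThrees (fun n => a (n + 6)) (fun n => x (n + 6)) (fun n => y (n + 6)) := by
  have hd : ∀ n, a (n + 6) = 3 → a (n + 7) = 1 ∧ a (n + 8) = 1 := fun n h3 =>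
    ⟨h.eq_one_of_eq_three (n := n + 3) h3,
      (h.digit_eq (n + 5)).resolve_right (h.ne_three_add_two (n := n + 2) h3)⟩
  refine
    { h.shift 6 with
      digit := fun n => h.digit_eq (n + 3)
      one_of_three := ?_
      x_ge := ?_
      y_ge := ?_ }
  · intro n h3
    have := hd n h3
    rwa [show n + 1 + 6 = n + 7 by omega, show n + 2 + 6 = n + 8 by omega]
  · intro n h3
    have h1 : a (n + 5) = 1 := h.pred_eq_one_of_eq_three (n := n + 2) h3
    exact h.le_x h1 (h.x_le_four_fifths (n + 2)) (by norm_num) (by norm_num)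
  · intro n h3
    exact h.le_y (hd n h3).1 (h.y_le_four_fifths _) (by norm_num) (by norm_num)

namespace SparseThrees

variable {a : ℕ → ℤ} {x y : ℕ → ℝ}

theorem x_le_of_three (h : SparseThrees a x y) {n : ℕ} (h3 : a n = 3) : x n ≤ 0.615 := by
  have hs := h.sum_le n
  have := h.y_ge n h3
  rw [h3] at hs
  push_cast at hs
  linarith

theorem y_le_of_three (h : SparseThrees a x y) {n : ℕ} (h3 : a n = 3) : y n ≤ 0.615 := by
  have hs := h.sum_le n
  have := h.x_ge n h3
  rw [h3] at hs
  push_cast at hs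
  linarith

theorem gap_eq (h : SparseThrees a x y) {n : ℕ} (h3 : a n = 3) (h1 : a (n + 3) = 1) :
    a (n + 4) = 1 ∧ a (n + 5) = 3 := by
  obtain ⟨d1, d2⟩ := h.one_of_three n h3
  have hy := h.y_le_of_three h3
  have h4 : a (n + 4) = 1 := by
    refine (h.digit _).resolve_right fun h4 => ?_
    have y3 : y (n + 3) ≤ 1 / 3 := h.y_le h4 (h.y_nonneg _) (by norm_num) (by norm_num)
    have y2 : 3 / 4 ≤ y (n + 2) := h.le_y h1 y3 (by norm_num) (by norm_num)
    have y1 : y (n + 1) ≤ 4 / 7 := h.y_le d2 y2 (by norm_num) (by norm_num)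
    have y0 : 7 / 11 ≤ y n := h.le_y d1 y1 (by norm_num) (by norm_num)
    linarith
  refine ⟨h4, (h.digit _).resolve_left fun h5 => ?_⟩
  have y4 : 1 / 2 ≤ y (n + 4) := h.le_y h5 (h.y_le_one _) (by norm_num) (by norm_num)
  have y3 : y (n + 3) ≤ 2 / 3 := h.y_le h4 y4 (by norm_num) (by norm_num)
  have y2 : 3 / 5 ≤ y (n + 2) := h.le_y h1 y3 (by norm_num) (by norm_num)
  have y1 : y (n + 1) ≤ 5 / 8 := h.y_le d2 y2 (by norm_num) (by norm_num)
  have y0 : 8 / 13 ≤ y n := h.le_y d1 y1 (by norm_num) (by norm_num)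
  linarith

end SparseThrees

/-- The digits `3, 1, 1, 1, 1, 3` occur from position `n` on. -/
def LongGap (a : ℕ → ℤ) (n : ℕ) : Prop :=
  a n = 3 ∧ a (n + 1) = 1 ∧ a (n + 2) = 1 ∧ a (n + 3) = 1 ∧ a (n + 4) = 1 ∧ a (n + 5) = 3

namespace SparseThrees

variable {a : ℕ → ℤ} {x y : ℕ → ℝ}

theorem longGap_of_ne (h : SparseThrees a x y) {n : ℕ} (h3 : a n = 3) (hne : a (n + 3) ≠ 3) :
    LongGap a n := by
  have h1 := (h.digit _).resolve_right hne
  obtain ⟨d1, d2⟩ := h.one_of_three n h3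
  obtain ⟨d4, d5⟩ := h.gap_eq h3 h1
  exact ⟨h3, d1, d2, h1, d4, d5⟩

theorem le_y_of_longGap (h : SparseThrees a x y) {n : ℕ} (hg : LongGap a n) :
    0.608 ≤ y n := by
  obtain ⟨-, h1, h2, h3, h4, h5⟩ := hg
  have y4 : 1 / 4 ≤ y (n + 4) := h.le_y h5 (h.y_le_one _) (by norm_num) (by norm_num)
  have y3 : y (n + 3) ≤ 4 / 5 := h.y_le h4 y4 (by norm_num) (by norm_num)
  have y2 : 5 / 9 ≤ y (n + 2) := h.le_y h3 y3 (by norm_num) (by norm_num)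
  have y1 : y (n + 1) ≤ 9 / 14 := h.y_le h2 y2 (by norm_num) (by norm_num)
  exact h.le_y h1 y1 (by norm_num) (by norm_num)

theorem le_x_of_longGap (h : SparseThrees a x y) {n : ℕ} (hg : LongGap a n) :
    0.60948 ≤ x (n + 5) := by
  obtain ⟨h0, h1, h2, h3, h4, -⟩ := hg
  have x0 := h.x_le_of_three h0
  have x1 : 0.2766 ≤ x (n + 1) := h.le_x h0 x0 (by norm_num) (by norm_num)
  have x2 : x (n + 2) ≤ 0.78334 := h.x_le h1 x1 (by norm_num) (by norm_num)
  have x3 : 0.56074 ≤ x (n + 3) := h.le_x h2 x2 (by norm_num) (by norm_num)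
  have x4 : x (n + 4) ≤ 0.64073 := h.x_le h3 x3 (by norm_num) (by norm_num)
  exact h.le_x h4 x4 (by norm_num) (by norm_num)

theorem longGap_add_eight (h : SparseThrees a x y) {n : ℕ} (hg : LongGap a n) :
    a (n + 6) = 1 ∧ a (n + 7) = 1 ∧ LongGap a (n + 8) := by
  have h5 : a (n + 5) = 3 := hg.2.2.2.2.2
  obtain ⟨h6, h7⟩ := h.one_of_three _ h5
  have hx := h.le_x_of_longGap hg
  have hs := h.sum_le (n + 5)
  rw [h5] at hs
  push_cast at hs
  have h8 : a (n + 8) = 3 := by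
    by_contra hne
    have := h.le_y_of_longGap (h.longGap_of_ne h5 hne)
    linarith
  refine ⟨h6, h7, h.longGap_of_ne h8 fun h11 => ?_⟩
  obtain ⟨h9, h10⟩ := h.one_of_three _ h8
  have y10 : y (n + 10) ≤ 1 / 3 := h.y_le h11 (h.y_nonneg _) (by norm_num) (by norm_num)
  have y9 : 3 / 4 ≤ y (n + 9) := h.le_y h10 y10 (by norm_num) (by norm_num)
  have y8 : y (n + 8) ≤ 4 / 7 := h.y_le h9 y9 (by norm_num) (by norm_num)
  have y7 : 7 / 25 ≤ y (n + 7) := h.le_y h8 y8 (by norm_num) (by norm_num)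
  have y6 : y (n + 6) ≤ 25 / 32 := h.y_le h7 y7 (by norm_num) (by norm_num)
  have y5 : 32 / 57 ≤ y (n + 5) := h.le_y h6 y6 (by norm_num) (by norm_num)
  linarith

theorem longGap_add (h : SparseThrees a x y) {n : ℕ} (hg : LongGap a n) (k : ℕ) :
    LongGap a (n + 8 * k) := by
  induction k with
  | zero => exact hg
  | succ k ih => exact (h.longGap_add_eight ih).2.2

theorem y_eq_of_longGap (h : SparseThrees a x y) {n : ℕ} (hg : LongGap a n) :
    y (n + 5) = (23 * y (n + 13) + 83) / (41 * y (n + 13) + 148) := by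
  obtain ⟨h6, h7, h8, h9, h10, h11, h12, h13⟩ := h.longGap_add_eight hg
  have := h.y_nonneg (n + 13)
  rw [h.y_eq (n + 5), h.y_eq (n + 5 + 1), h.y_eq (n + 5 + 1 + 1), h.y_eq (n + 5 + 1 + 1 + 1),
    h.y_eq (n + 5 + 1 + 1 + 1 + 1), h.y_eq (n + 5 + 1 + 1 + 1 + 1 + 1),
    h.y_eq (n + 5 + 1 + 1 + 1 + 1 + 1 + 1), h.y_eq (n + 5 + 1 + 1 + 1 + 1 + 1 + 1 + 1)]
  simp only [add_assoc, Nat.reduceAdd] at *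
  rw [h6, h7, h8, h9, h10, h11, h12, h13]
  push_cast
  field_simp
  ring

theorem x_eq_of_longGap (h : SparseThrees a x y) {n : ℕ} (hg : LongGap a n) :
    x (n + 13) = (25 * x (n + 5) + 89) / (41 * x (n + 5) + 146) := by
  obtain ⟨h6, h7, h8, h9, h10, h11, h12, h13⟩ := h.longGap_add_eight hg
  have h5 : a (n + 5) = 3 := hg.2.2.2.2.2
  have := h.x_nonneg (n + 5)
  rw [h.x_succ (n + 12), h.x_succ (n + 11), h.x_succ (n + 10), h.x_succ (n + 9),
    h.x_succ (n + 8), h.x_succ (n + 7), h.x_succ (n + 6), h.x_succ (n + 5)]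
  simp only [add_assoc, Nat.reduceAdd] at *
  rw [h5, h6, h7, h8, h9, h10, h11, h12]
  push_cast
  field_simp
  ring

end SparseThrees

theorem abs_moebius_sub_le {u z p q r s w : ℝ} (hu : u = (p * z + q) / (r * z + s))
    (hdet : p * s - q * r = 1) (hw : w * (r * w + s) = p * w + q) (hz : 0 ≤ z) (hw0 : 0 ≤ w)
    (hr : 0 ≤ r) (hs : 2 ≤ s) : |u - w| ≤ |z - w| / 2 := by
  have h1 : 2 ≤ r * z + s := by nlinarith [mul_nonneg hr hz]
  have h2 : 2 ≤ r * w + s := by nlinarith [mul_nonneg hr hw0]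
  have h3 : 2 ≤ (r * z + s) * (r * w + s) := by nlinarith
  have key : (u - w) * ((r * z + s) * (r * w + s)) = z - w := by
    have hu' : u * (r * z + s) = p * z + q := by rw [hu]; field_simp
    linear_combination (r * w + s) * hu' - (r * z + s) * hw + (z - w) * hdet
  have habs : |u - w| * ((r * z + s) * (r * w + s)) = |z - w| := by
    rw [← key, abs_mul, abs_of_pos (by linarith : (0 : ℝ) < (r * z + s) * (r * w + s))]
  nlinarith [abs_nonneg (u - w)]

namespace SparseThrees

variable {a : ℕ → ℤ} {x y : ℕ → ℝ}

theorem abs_y_sub_le (h : SparseThrees a x y) {w : ℝ} (hw : w * (41 * w + 148) = 23 * w + 83)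
    (hw0 : 0 ≤ w) (hw1 : w ≤ 1) (k : ℕ) :
    ∀ n, LongGap a n → |y (n + 5) - w| ≤ (1 / 2) ^ k := by
  induction k with
  | zero =>
    intro n _
    rw [pow_zero, abs_le]
    constructor <;> linarith [h.y_nonneg (n + 5), h.y_le_one (n + 5)]
  | succ k ih =>
    intro n hg
    have h1 := ih (n + 8) (h.longGap_add_eight hg).2.2
    have h2 := abs_moebius_sub_le (h.y_eq_of_longGap hg) (by norm_num) hw (h.y_nonneg _) hw0
      (by norm_num) (by norm_num)
    rw [pow_succ]
    have : |y (n + 13) - w| ≤ (1 / 2) ^ k := h1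
    linarith

theorem abs_x_sub_le (h : SparseThrees a x y) {w : ℝ} (hw : w * (41 * w + 146) = 25 * w + 89)
    (hw0 : 0 ≤ w) (hw1 : w ≤ 1) {n : ℕ} (hg : LongGap a n) (k : ℕ) :
    |x (n + 8 * k + 5) - w| ≤ (1 / 2) ^ k := by
  induction k with
  | zero =>
    rw [pow_zero, abs_le]
    constructor <;> linarith [h.x_nonneg (n + 8 * 0 + 5), h.x_le_one (n + 8 * 0 + 5)]
  | succ k ih =>
    have h2 := abs_moebius_sub_le (h.x_eq_of_longGap (h.longGap_add hg k)) (by norm_num) hw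
      (h.x_nonneg _) hw0 (by norm_num) (by norm_num)
    rw [pow_succ]
    have : |x (n + 8 * (k + 1) + 5) - w| ≤ |x (n + 8 * k + 5) - w| / 2 := h2
    linarith

theorem not_longGap (h : SparseThrees a x y) {K : ℝ} (hK : K < 13 * √173 / 41)
    (hle : ∀ n, (a n : ℝ) + x n + y n ≤ K) (n : ℕ) : ¬ LongGap a n := by
  intro hg
  have hsq : √173 * √173 = 173 := Real.mul_self_sqrt (by norm_num)
  have hlo : 13 < √173 := Real.lt_sqrt_of_sq_lt (by norm_num)
  have hhi : √173 < 14 := by rw [Real.sqrt_lt' (by norm_num)]; norm_num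
  obtain ⟨k, hk⟩ := exists_pow_lt_of_lt_one (y := (1 / 2 : ℝ))
    (show 0 < (13 * √173 / 41 - K) / 2 by linarith) (by norm_num)
  have hx := h.abs_x_sub_le (w := (13 * √173 - 121) / 82) (by nlinarith) (by linarith)
    (by linarith) hg k
  have hg' := h.longGap_add hg k
  have hy := h.abs_y_sub_le (w := (13 * √173 - 125) / 82) (by nlinarith) (by linarith)
    (by linarith) k _ hg'
  have h3 : a (n + 8 * k + 5) = 3 := hg'.2.2.2.2.2
  have hs := hle (n + 8 * k + 5)
  rw [h3] at hs
  push_cast at hs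
  have := (abs_le.1 hx).1
  have := (abs_le.1 hy).1
  linarith

theorem eventually_periodic (h : SparseThrees a x y) {K : ℝ} (hK : K < 13 * √173 / 41)
    (hle : ∀ n, (a n : ℝ) + x n + y n ≤ K) :
    (∀ n, a n = 1) ∨ ∃ m, ∀ k, a (m + 3 * k) = 3 ∧ a (m + 3 * k + 1) = 1 ∧
      a (m + 3 * k + 2) = 1 := by
  by_cases hone : ∀ n, a n = 1
  · exact Or.inl hone
  push Not at hone
  obtain ⟨m, hm⟩ := hone
  have key : ∀ k, a (m + 3 * k) = 3 := by
    intro k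
    induction k with
    | zero => exact (h.digit m).resolve_left hm
    | succ k ih =>
      by_contra hne
      exact h.not_longGap hK hle _ (h.longGap_of_ne ih hne)
  exact Or.inr ⟨m, fun k => ⟨key k, h.one_of_three _ (key k)⟩⟩

end SparseThrees

/-! ### Continued fraction digits -/

theorem cfTail_succ (α : ℝ) (n : ℕ) : cfTail α (n + 1) = (Int.fract (cfTail α n))⁻¹ := rfl

theorem cfTail_irrational {α : ℝ} (hα : Irrational α) (n : ℕ) : Irrational (cfTail α n) := by
  induction n with
  | zero => exact hα
  | succ n ih =>
    rw [cfTail_succ, irrational_inv_iff, Int.fract, irrational_sub_intCast_iff]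
    exact ih

theorem fract_cfTail_pos {α : ℝ} (hα : Irrational α) (n : ℕ) : 0 < Int.fract (cfTail α n) := by
  refine (Int.fract_nonneg _).lt_of_ne fun h => ?_
  exact (cfTail_irrational hα n).ne_int ⌊cfTail α n⌋ (by linarith [Int.floor_add_fract (cfTail α n)])

theorem one_lt_cfTail {α : ℝ} (hα : Irrational α) (n : ℕ) : 1 < cfTail α (n + 1) := by
  rw [cfTail_succ]
  exact (one_lt_inv₀ (fract_cfTail_pos hα n)).2 (Int.fract_lt_one _)

theorem cfDigit_add_fract (α : ℝ) (n : ℕ) :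
    (cfDigit α n : ℝ) + Int.fract (cfTail α n) = cfTail α n :=
  Int.floor_add_fract _

theorem one_le_cfDigit {α : ℝ} (hα : Irrational α) (n : ℕ) : 1 ≤ cfDigit α (n + 1) :=
  Int.le_floor.2 (by exact_mod_cast (one_lt_cfTail hα n).le)

theorem cfDen_pos {α : ℝ} (hα : Irrational α) (n : ℕ) :
    1 ≤ cfDen α n ∧ 1 ≤ cfDen α (n + 1) := by
  induction n with
  | zero => exact ⟨le_rfl, one_le_cfDigit hα 0⟩
  | succ n ih =>
    refine ⟨ih.2, ?_⟩
    have := one_le_cfDigit hα (n + 1)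
    have : cfDen α (n + 2) = cfDigit α (n + 2) * cfDen α (n + 1) + cfDen α n := rfl
    nlinarith

theorem cfDen_add_le {α : ℝ} (hα : Irrational α) (n : ℕ) :
    cfDen α (n + 1) + cfDen α n ≤ cfDen α (n + 2) := by
  have := one_le_cfDigit hα (n + 1)
  have : cfDen α (n + 2) = cfDigit α (n + 2) * cfDen α (n + 1) + cfDen α n := rfl
  nlinarith [(cfDen_pos hα n).2]

theorem cfDen_monotone {α : ℝ} (hα : Irrational α) : Monotone (cfDen α) := by
  refine monotone_nat_of_le_succ fun n => ?_
  cases n with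
  | zero => exact one_le_cfDigit hα 0
  | succ n => linarith [cfDen_add_le hα n, (cfDen_pos hα n).1]

theorem le_cfDen {α : ℝ} (hα : Irrational α) (n : ℕ) : (n : ℤ) ≤ cfDen α n := by
  induction n with
  | zero => exact zero_le_one
  | succ n ih =>
    cases n with
    | zero => exact one_le_cfDigit hα 0
    | succ n =>
      have := cfDen_add_le hα n
      have := (cfDen_pos hα n).1
      push_cast at *
      linarith

theorem cfNum_mul_cfDen_sub (α : ℝ) (n : ℕ) :
    cfNum α (n + 1) * cfDen α n - cfNum α n * cfDen α (n + 1) = (-1) ^ n := by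
  induction n with
  | zero => simp only [cfNum, cfDen]; ring
  | succ n ih =>
    have h1 : cfDen α (n + 2) = cfDigit α (n + 2) * cfDen α (n + 1) + cfDen α n := rfl
    have h2 : cfNum α (n + 2) = cfDigit α (n + 2) * cfNum α (n + 1) + cfNum α n := rfl
    rw [h1, h2, pow_succ, ← ih]
    ring

theorem cfTail_mul_error {α : ℝ} (hα : Irrational α) (n : ℕ) :
    cfTail α (n + 2) * (cfDen α (n + 1) * α - cfNum α (n + 1)) +
      (cfDen α n * α - cfNum α n) = 0 := by
  induction n with
  | zero =>
    have h0 := cfDigit_add_fract α 0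
    have h1 := cfDigit_add_fract α 1
    have e1 : cfTail α 1 * Int.fract (cfTail α 0) = 1 :=
      inv_mul_cancel₀ (fract_cfTail_pos hα 0).ne'
    have e2 : cfTail α 2 * Int.fract (cfTail α 1) = 1 :=
      inv_mul_cancel₀ (fract_cfTail_pos hα 1).ne'
    have hα0 : cfTail α 0 = α := rfl
    simp only [cfNum, cfDen, zero_add]
    push_cast
    rw [hα0] at h0 e1
    have f0 : Int.fract α = α - cfDigit α 0 := by linarith
    have f1 : Int.fract (cfTail α 1) = cfTail α 1 - cfDigit α 1 := by linarith
    rw [f0] at e1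
    rw [f1] at e2
    linear_combination (cfTail α 2) * e1 - (α - cfDigit α 0) * e2
  | succ n ih =>
    have h1 : cfDen α (n + 2) = cfDigit α (n + 2) * cfDen α (n + 1) + cfDen α n := rfl
    have h2 : cfNum α (n + 2) = cfDigit α (n + 2) * cfNum α (n + 1) + cfNum α n := rfl
    have e : cfTail α (n + 3) * Int.fract (cfTail α (n + 2)) = 1 :=
      inv_mul_cancel₀ (fract_cfTail_pos hα (n + 2)).ne'
    have hd := cfDigit_add_fract α (n + 2)
    have f : Int.fract (cfTail α (n + 2)) = cfTail α (n + 2) - cfDigit α (n + 2) := by linarith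
    rw [f] at e
    rw [h1, h2]
    push_cast
    linear_combination (cfTail α (n + 3)) * ih -
      (cfDen α (n + 1) * α - cfNum α (n + 1)) * e

theorem abs_error_mul {α : ℝ} (hα : Irrational α) (n : ℕ) :
    |cfDen α (n + 1) * α - cfNum α (n + 1)| *
      (cfDen α (n + 1) * cfTail α (n + 2) + cfDen α n) = 1 := by
  have h1 := cfTail_mul_error hα n
  have h2 : (cfNum α (n + 1) * cfDen α n - cfNum α n * cfDen α (n + 1) : ℝ) = (-1) ^ n := by
    exact_mod_cast cfNum_mul_cfDen_sub α n
  have hT := one_lt_cfTail hα (n + 1)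
  have hQ : (1 : ℝ) ≤ cfDen α n := by exact_mod_cast (cfDen_pos hα n).1
  have hQ' : (1 : ℝ) ≤ cfDen α (n + 1) := by exact_mod_cast (cfDen_pos hα n).2
  have hpos : 0 < cfDen α (n + 1) * cfTail α (n + 2) + cfDen α n := by
    have : cfTail α (n + 1 + 1) = cfTail α (n + 2) := rfl
    nlinarith
  have key : (cfDen α (n + 1) * α - cfNum α (n + 1)) *
      (cfDen α (n + 1) * cfTail α (n + 2) + cfDen α n) = -(-1) ^ n := by
    rw [← h2]
    linear_combination (cfDen α (n + 1) : ℝ) * h1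
  rw [← abs_of_pos hpos, ← abs_mul, key, abs_neg, abs_pow, abs_neg, abs_one, one_pow]

/-! ### Pairs that are not convergents -/

theorem two_mul_ne_convergent (α : ℝ) (p q : ℤ) (n : ℕ) :
    (2 * p, 2 * q) ≠ (cfNum α n, cfDen α n) := by
  intro h
  rw [Prod.mk.injEq] at h
  have hdet := cfNum_mul_cfDen_sub α n
  rw [← h.1, ← h.2] at hdet
  have h2 : (2 : ℤ) ∣ (-1) ^ n := ⟨cfNum α (n + 1) * q - p * cfDen α (n + 1), by
    rw [← hdet]; ring⟩
  rcases neg_one_pow_eq_or ℤ n with hn | hn <;> rw [hn] at h2 <;> omega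

theorem ne_convergent_of_lt_of_lt {α : ℝ} (hα : Irrational α) {p q : ℤ} {m : ℕ}
    (h1 : cfDen α m < q) (h2 : q < cfDen α (m + 1)) (n : ℕ) :
    (p, q) ≠ (cfNum α n, cfDen α n) := by
  intro h
  rw [Prod.mk.injEq] at h
  rw [h.2] at h1 h2
  have := (cfDen_monotone hα).reflect_lt h1
  have := (cfDen_monotone hα).reflect_lt h2
  omega

theorem psi2_le {α : ℝ} {p q : ℤ} (hq : 1 ≤ q)
    (h : ∀ n : ℕ, (p, q) ≠ (cfNum α n, cfDen α n)) : psi2 α q ≤ |(q : ℝ) * α - p| := by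
  refine csInf_le ⟨0, ?_⟩ ⟨p, q, hq, le_rfl, h, rfl⟩
  rintro _ ⟨_, _, _, _, _, rfl⟩
  exact abs_nonneg _

theorem psi2_nonneg (α t : ℝ) : 0 ≤ psi2 α t := by
  refine Real.sInf_nonneg ?_
  rintro _ ⟨_, _, _, _, _, rfl⟩
  exact abs_nonneg _

theorem exists_forall_lt_of_lt_kConst {α c : ℝ} (hc : c < kConst α) :
    ∃ N : ℕ, ∀ p q : ℤ, (N : ℤ) ≤ q → (∀ n : ℕ, (p, q) ≠ (cfNum α n, cfDen α n)) →
      c < q * |(q : ℝ) * α - p| := by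
  have hb : IsBoundedUnder (· ≥ ·) atTop (fun t : ℝ => t * psi2 α t) :=
    isBoundedUnder_of_eventually_ge (a := 0) ((eventually_ge_atTop 0).mono fun t ht =>
      mul_nonneg ht (psi2_nonneg α t))
  obtain ⟨t, ht⟩ := eventually_atTop.1 (eventually_lt_of_lt_liminf hc hb)
  obtain ⟨N, hN⟩ := exists_nat_ge t
  refine ⟨N + 1, fun p q hq hpq => ?_⟩
  have hq1 : 1 ≤ q := by push_cast at hq; omega
  have hq' : ((N : ℝ) + 1) ≤ q := by exact_mod_cast hq
  have hqpos : (0 : ℝ) < q := by exact_mod_cast hq1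
  exact (ht q (by linarith)).trans_le (mul_le_mul_of_nonneg_left (psi2_le hq1 hpq) hqpos.le)

/-! ### Values at doubled convergents and at intermediate fractions -/

theorem doubled_convergent_value {α : ℝ} (hα : Irrational α) (n : ℕ) :
    ((2 * cfDen α (n + 1) : ℤ) : ℝ) *
        |((2 * cfDen α (n + 1) : ℤ) : ℝ) * α - ((2 * cfNum α (n + 1) : ℤ) : ℝ)| *
      (cfTail α (n + 2) + cfDen α n / cfDen α (n + 1)) = 4 := by
  have h := abs_error_mul hα n
  have hQ' : (1 : ℝ) ≤ cfDen α (n + 1) := by exact_mod_cast (cfDen_pos hα n).2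
  have e : ((2 * cfDen α (n + 1) : ℤ) : ℝ) * α - ((2 * cfNum α (n + 1) : ℤ) : ℝ) =
      2 * (cfDen α (n + 1) * α - cfNum α (n + 1)) := by push_cast; ring
  rw [e, abs_mul, abs_two]
  push_cast
  field_simp
  linear_combination 4 * h

theorem intermediate_value {α : ℝ} (hα : Irrational α) (n : ℕ) :
    ((cfDen α (n + 2) - cfDen α (n + 1) : ℤ) : ℝ) *
        |((cfDen α (n + 2) - cfDen α (n + 1) : ℤ) : ℝ) * α -
          ((cfNum α (n + 2) - cfNum α (n + 1) : ℤ) : ℝ)| *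
      (cfTail α (n + 2) + cfDen α n / cfDen α (n + 1)) =
    (cfDigit α (n + 2) - 1 + cfDen α n / cfDen α (n + 1)) *
      (1 + Int.fract (cfTail α (n + 2))) := by
  have h := abs_error_mul hα n
  have hT := cfTail_mul_error hα n
  have hQ' : (1 : ℝ) ≤ cfDen α (n + 1) := by exact_mod_cast (cfDen_pos hα n).2
  have h1 : cfDen α (n + 2) = cfDigit α (n + 2) * cfDen α (n + 1) + cfDen α n := rfl
  have h2 : cfNum α (n + 2) = cfDigit α (n + 2) * cfNum α (n + 1) + cfNum α n := rfl
  have hd := cfDigit_add_fract α (n + 2)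
  have hf := Int.fract_nonneg (cfTail α (n + 2))
  have e : ((cfDen α (n + 2) - cfDen α (n + 1) : ℤ) : ℝ) * α -
      ((cfNum α (n + 2) - cfNum α (n + 1) : ℤ) : ℝ) =
      -((1 + Int.fract (cfTail α (n + 2))) * (cfDen α (n + 1) * α - cfNum α (n + 1))) := by
    rw [h1, h2]
    push_cast
    linear_combination hT + (cfDen α (n + 1) * α - cfNum α (n + 1)) * hd
  rw [e, abs_neg, abs_mul, abs_of_nonneg (by linarith : 0 ≤ 1 + Int.fract (cfTail α (n + 2))), h1]
  push_cast
  field_simp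
  linear_combination ((cfDigit α (n + 2) - 1) * cfDen α (n + 1) + cfDen α n) * h

theorem intermediate_ne_convergent {α : ℝ} (hα : Irrational α) {n : ℕ}
    (h2 : 2 ≤ cfDigit α (n + 2)) (k : ℕ) :
    (cfNum α (n + 2) - cfNum α (n + 1), cfDen α (n + 2) - cfDen α (n + 1)) ≠
      (cfNum α k, cfDen α k) := by
  have h1 : cfDen α (n + 2) = cfDigit α (n + 2) * cfDen α (n + 1) + cfDen α n := rfl
  have := cfDen_pos hα n
  refine ne_convergent_of_lt_of_lt hα (m := n + 1) ?_ ?_ k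
  · nlinarith
  · show _ < cfDen α (n + 2)
    linarith

/-! ### Digits of the two excluded quadratic irrationals -/

theorem cfTail_golden (n : ℕ) : cfTail ((1 + √5) / 2) n = (1 + √5) / 2 := by
  have hsq : √5 * √5 = 5 := Real.mul_self_sqrt (by norm_num)
  have hlo : 2 < √5 := Real.lt_sqrt_of_sq_lt (by norm_num)
  have hhi : √5 < 3 := by rw [Real.sqrt_lt' (by norm_num)]; norm_num
  induction n with
  | zero => rfl
  | succ n ih =>
    have hfl : ⌊(1 + √5) / 2⌋ = 1 := by
      rw [Int.floor_eq_iff]; push_cast; constructor <;> linarith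
    rw [cfTail_succ, ih, Int.fract, hfl]
    refine inv_eq_of_mul_eq_one_left ?_
    push_cast
    nlinarith

theorem cfDigit_golden (n : ℕ) : cfDigit ((1 + √5) / 2) n = 1 := by
  have hlo : 2 < √5 := Real.lt_sqrt_of_sq_lt (by norm_num)
  have hhi : √5 < 3 := by rw [Real.sqrt_lt' (by norm_num)]; norm_num
  rw [cfDigit, cfTail_golden, Int.floor_eq_iff]
  push_cast
  constructor <;> linarith

theorem cfTail_succ_eq_of_floor {α u v : ℝ} {d : ℤ} {n : ℕ} (h : cfTail α n = u) (hd : ⌊u⌋ = d)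
    (huv : v * (u - d) = 1) : cfTail α (n + 1) = v := by
  rw [cfTail_succ, h, Int.fract, hd]
  exact (eq_inv_of_mul_eq_one_left huv).symm

theorem cfDigit_sqrt_seventeen (k : ℕ) :
    cfDigit ((1 + √17) / 2) (3 + 3 * k) = 3 ∧ cfDigit ((1 + √17) / 2) (3 + 3 * k + 1) = 1 ∧
      cfDigit ((1 + √17) / 2) (3 + 3 * k + 2) = 1 := by
  have hsq : √17 * √17 = 17 := Real.mul_self_sqrt (by norm_num)
  have hlo : 4 < √17 := Real.lt_sqrt_of_sq_lt (by norm_num)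
  have hhi : √17 < 5 := by rw [Real.sqrt_lt' (by norm_num)]; norm_num
  have f0 : ⌊(1 + √17) / 2⌋ = 2 := by
    rw [Int.floor_eq_iff]; push_cast; constructor <;> linarith
  have f1 : ⌊(3 + √17) / 4⌋ = 1 := by
    rw [Int.floor_eq_iff]; push_cast; constructor <;> linarith
  have f2 : ⌊(1 + √17) / 4⌋ = 1 := by
    rw [Int.floor_eq_iff]; push_cast; constructor <;> linarith
  have f3 : ⌊(3 + √17) / 2⌋ = 3 := by
    rw [Int.floor_eq_iff]; push_cast; constructor <;> linarith
  have s1 : ∀ n, cfTail ((1 + √17) / 2) n = (3 + √17) / 4 →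
      cfTail ((1 + √17) / 2) (n + 1) = (1 + √17) / 4 := fun n h =>
    cfTail_succ_eq_of_floor h f1 (by push_cast; nlinarith)
  have s2 : ∀ n, cfTail ((1 + √17) / 2) n = (1 + √17) / 4 →
      cfTail ((1 + √17) / 2) (n + 1) = (3 + √17) / 2 := fun n h =>
    cfTail_succ_eq_of_floor h f2 (by push_cast; nlinarith)
  have s3 : ∀ n, cfTail ((1 + √17) / 2) n = (3 + √17) / 2 →
      cfTail ((1 + √17) / 2) (n + 1) = (3 + √17) / 4 := fun n h =>
    cfTail_succ_eq_of_floor h f3 (by push_cast; nlinarith)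
  have t3 : cfTail ((1 + √17) / 2) (3 + 3 * k) = (3 + √17) / 2 := by
    induction k with
    | zero =>
      have t1 : cfTail ((1 + √17) / 2) (0 + 1) = (3 + √17) / 4 :=
        cfTail_succ_eq_of_floor (n := 0) (u := (1 + √17) / 2) rfl f0 (by push_cast; nlinarith)
      exact s2 _ (s1 _ t1)
    | succ k ih => exact s2 _ (s1 _ (s3 _ ih))
  refine ⟨?_, ?_, ?_⟩
  · rw [cfDigit, t3, f3]
  · rw [cfDigit, s3 _ t3, f1]
  · have := s1 _ (s3 _ t3)
    rw [cfDigit, this, f2]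

/-! ### Conclusion -/

theorem cfEquiv_or_of_lt_kConst {α : ℝ} (hα : Irrational α)
    (hc : 164 / (13 * √173) < kConst α) :
    CFEquiv α ((1 + √5) / 2) ∨ CFEquiv α ((1 + √17) / 2) := by
  have hlo : 13 < √173 := Real.lt_sqrt_of_sq_lt (by norm_num)
  have hhi : √173 < 13.153 := by rw [Real.sqrt_lt' (by norm_num)]; norm_num
  obtain ⟨c, hc1, hc2⟩ := exists_between hc
  obtain ⟨N, hN⟩ := exists_forall_lt_of_lt_kConst hc2
  have hc0 : 0.959 < c := by
    refine lt_trans ?_ hc1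
    rw [lt_div_iff₀ (by linarith)]
    linarith
  have hK : 4 / c < 13 * √173 / 41 := by
    rw [div_lt_iff₀ (by linarith)] at hc1 ⊢
    linarith
  set a : ℕ → ℤ := fun n => cfDigit α (n + N + 2) with ha
  set x : ℕ → ℝ := fun n => cfDen α (n + N) / cfDen α (n + N + 1) with hx
  set y : ℕ → ℝ := fun n => Int.fract (cfTail α (n + N + 2)) with hy
  have hQ : ∀ n, (1 : ℝ) ≤ cfDen α n := fun n => by exact_mod_cast (cfDen_pos hα n).1
  have hsum : ∀ n, cfTail α (n + N + 2) + cfDen α (n + N) / cfDen α (n + N + 1) =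
      (a n : ℝ) + x n + y n := fun n => by
    rw [← cfDigit_add_fract α (n + N + 2)]
    simp only [ha, hx, hy]
    ring
  have hx0 : ∀ n, 0 ≤ x n := fun n =>
    div_nonneg (by linarith [hQ (n + N)]) (by linarith [hQ (n + N + 1)])
  have hy0 : ∀ n, 0 ≤ y n := fun n => Int.fract_nonneg _
  have ha1 : ∀ n, 1 ≤ a n := fun n => one_le_cfDigit hα _
  have hpos : ∀ n, 0 < (a n : ℝ) + x n + y n := fun n => by
    have : (1 : ℝ) ≤ a n := by exact_mod_cast ha1 n
    linarith [hx0 n, hy0 n]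
  have hNQ : ∀ n, (N : ℤ) ≤ cfDen α (n + N + 1) := fun n => by
    have := le_cfDen hα (n + N + 1)
    push_cast at this
    omega
  have hle : ∀ n, (a n : ℝ) + x n + y n ≤ 4 / c := by
    intro n
    have h1 := doubled_convergent_value hα (n + N)
    have h2 := hN (2 * cfNum α (n + N + 1)) (2 * cfDen α (n + N + 1))
      (by have := hNQ n; omega) (two_mul_ne_convergent α _ _)
    rw [hsum] at h1
    rw [le_div_iff₀ (by linarith)]
    nlinarith [hpos n]
  have hlarge : LargeKappa a x y := by
    refine ⟨ha1, hx0, ?_, hy0, fun n => (Int.fract_lt_one _).le, ?_, ?_, ?_, ?_⟩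
    · intro n
      refine div_le_one_of_le₀ ?_ (by linarith [hQ (n + N + 1)])
      exact_mod_cast cfDen_monotone hα (Nat.le_succ (n + N))
    · intro n
      have e1 : n + 1 + N = n + N + 1 := by omega
      have h1 : cfDen α (n + N + 2) =
        cfDigit α (n + N + 2) * cfDen α (n + N + 1) + cfDen α (n + N) := rfl
      have := hQ (n + N + 1)
      simp only [ha, hx, e1]
      rw [show n + N + 1 + 1 = n + N + 2 from rfl, h1]
      push_cast
      rw [← inv_div]
      congr 1
      field_simp
    · intro n
      have e1 : n + 1 + N + 2 = n + N + 2 + 1 := by omega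
      simp only [ha, hy, e1]
      rw [cfDigit_add_fract, cfTail_succ α (n + N + 2), inv_inv]
    · intro n
      refine (hle n).trans (hK.le.trans ?_)
      linarith
    · intro n h2
      have h1 := intermediate_value hα (n + N)
      have h3 := hN _ _ (by
        have := hNQ n
        have h1 : cfDen α (n + N + 2) =
          cfDigit α (n + N + 2) * cfDen α (n + N + 1) + cfDen α (n + N) := rfl
        have := cfDen_pos hα (n + N)
        have : 2 ≤ cfDigit α (n + N + 2) := h2
        nlinarith) (intermediate_ne_convergent hα h2)
      rw [hsum] at h1
      have h4 : (cfDigit α (n + N + 2) - 1 + cfDen α (n + N) / cfDen α (n + N + 1)) *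
        (1 + Int.fract (cfTail α (n + N + 2))) = ((a n : ℝ) - 1 + x n) * (1 + y n) := rfl
      rw [← h4, ← h1]
      exact mul_le_mul_of_nonneg_right (by linarith) (hpos n).le
  rcases hlarge.sparseThrees.eventually_periodic hK (fun n => hle (n + 6)) with h | ⟨m, h⟩
  · refine Or.inl ⟨N + 8, 1, by omega, by omega, fun k _ => ?_⟩
    rw [cfDigit_golden, ← h k]
    simp only [ha]
    congr 1
    omega
  · refine Or.inr ⟨m + N + 8, 3, by omega, by omega, fun k _ => ?_⟩
    obtain ⟨j, r, hr, rfl⟩ : ∃ j r, r < 3 ∧ k = 3 * j + r :=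
      ⟨k / 3, k % 3, Nat.mod_lt _ (by norm_num), (Nat.div_add_mod k 3).symm⟩
    obtain ⟨b0, b1, b2⟩ := cfDigit_sqrt_seventeen j
    obtain ⟨c0, c1, c2⟩ := h j
    simp only [ha] at c0 c1 c2
    interval_cases r
    · rw [show 3 + (3 * j + 0) = 3 + 3 * j by omega, b0, ← c0]
      congr 1
      omega
    · rw [show 3 + (3 * j + 1) = 3 + 3 * j + 1 by omega, b1, ← c1]
      congr 1
      omega
    · rw [show 3 + (3 * j + 2) = 3 + 3 * j + 2 by omega, b2, ← c2]
      congr 1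
      omega

/-- If `α` is irrational and equivalent neither to `(1+√5)/2` nor to `(1+√17)/2`,
then `𝔨(α) ≤ 164/(13√173)`. -/
theorem stmt_5 (α : ℝ) (hα : Irrational α)
    (h5 : ¬ CFEquiv α ((1 + Real.sqrt 5) / 2))
    (h17 : ¬ CFEquiv α ((1 + Real.sqrt 17) / 2)) :
    kConst α ≤ 164 / (13 * Real.sqrt 173) := by
  by_contra! hc
  exact (cfEquiv_or_of_lt_kConst hα hc).elim h5 h17
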